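/- Let λ > 0, let Y ~ Exp(λ) and let Z be a standard Gaussian random variable (mean 0, variance 1), with Y and Z independent. Then √Y · |Z| is exponentially distributed with rate √(2λ); that is, for every w ≥ 0, ℙ(√Y · |Z| > w) = e^{−√(2λ)·w}. -/

import Mathlib

open MeasureTheory ProbabilityTheory
open scoped ENNReal

lemma hasDerivAt_add_mul_sqrt_sq_add {c : ℝ} (hc : 0 < c) (ε u : ℝ) :
    HasDerivAt (fun u : ℝ ↦ (u + ε * √(u ^ 2 + 4 * c)) / 2)
      ((1 + ε * (u / √(u ^ 2 + 4 * c))) / 2) u := by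
  have hpos : 0 < u ^ 2 + 4 * c := by positivity
  have hroot : HasDerivAt (fun u : ℝ ↦ √(u ^ 2 + 4 * c)) (2 * u / (2 * √(u ^ 2 + 4 * c))) u :=
    HasDerivAt.sqrt (by simpa using (hasDerivAt_pow 2 u).add_const (4 * c)) hpos.ne'
  refine (((hasDerivAt_id' u).fun_add (hroot.const_mul ε)).div_const 2).congr_deriv ?_
  rw [mul_div_mul_left _ _ two_ne_zero]

/-- On the half line of sign `ε`, the change of variables `u = x - c / x` has inverse
`x = (u + ε √(u² + 4c)) / 2`. -/
lemma setLIntegral_comp_sub_div {c : ℝ} (hc : 0 < c) {ε : ℝ} (hε : ε ^ 2 = 1) (g : ℝ → ℝ≥0∞) :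
    ∫⁻ x in {x | 0 < ε * x}, g (x - c / x)
      = ∫⁻ u, ENNReal.ofReal ((1 + ε * (u / √(u ^ 2 + 4 * c))) / 2) * g u := by
  set S : ℝ → ℝ := fun u ↦ (u + ε * √(u ^ 2 + 4 * c)) / 2 with hS
  have hsq (u : ℝ) : √(u ^ 2 + 4 * c) ^ 2 = u ^ 2 + 4 * c := Real.sq_sqrt (by positivity)
  have habs (u : ℝ) : |u| < √(u ^ 2 + 4 * c) :=
    abs_lt_of_sq_lt_sq (by rw [hsq]; linarith) (Real.sqrt_nonneg _)
  have hεu (u : ℝ) : |ε * u| < √(u ^ 2 + 4 * c) := by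
    have : |ε| = 1 := (pow_eq_one_iff_of_nonneg (abs_nonneg ε) two_ne_zero).1
      (by rw [sq_abs, hε])
    rw [abs_mul, this, one_mul]
    exact habs u
  have hSpos (u : ℝ) : 0 < ε * S u := by
    have : ε * S u = (ε * u + ε ^ 2 * √(u ^ 2 + 4 * c)) / 2 := by simp only [hS]; ring
    rw [this, hε]
    linarith [neg_abs_le (ε * u), hεu u]
  have hSinv (u : ℝ) : S u - c / S u = u := by
    have h0 : S u ≠ 0 := fun h ↦ by simpa [h] using hSpos u
    have : S u ^ 2 - u * S u = c := by
      simp only [hS]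
      linear_combination (1 / 4) * √(u ^ 2 + 4 * c) ^ 2 * hε + (1 / 4) * hsq u
    field_simp
    linarith
  have hinj : Function.Injective S := Function.LeftInverse.injective (g := fun x ↦ x - c / x) hSinv
  have himg : S '' Set.univ = {x | 0 < ε * x} := by
    ext x
    simp only [Set.image_univ, Set.mem_range, Set.mem_ofPred_eq]
    refine ⟨fun ⟨u, hu⟩ ↦ hu ▸ hSpos u, fun hx ↦ ⟨x - c / x, ?_⟩⟩
    have h0 : x ≠ 0 := fun h ↦ by simp [h] at hx
    have hx' : ε * (x + c / x) = ε * x + c * ε ^ 2 / (ε * x) := by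
      have : ε ≠ 0 := fun h ↦ by simp [h] at hx
      field_simp
    have hroot : √((x - c / x) ^ 2 + 4 * c) = ε * (x + c / x) := by
      rw [Real.sqrt_eq_iff_mul_self_eq (by positivity)
        (by rw [hx', hε]; positivity)]
      rw [show ε * (x + c / x) * (ε * (x + c / x)) = ε ^ 2 * (x + c / x) ^ 2 by ring, hε]
      field_simp
      ring
    simp only [hS, hroot]
    linear_combination (1 / 2) * (x + c / x) * hε
  have key := lintegral_image_eq_lintegral_abs_deriv_mul MeasurableSet.univ
    (fun u _ ↦ (hasDerivAt_add_mul_sqrt_sq_add hc ε u).hasDerivWithinAt) hinj.injOn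
    (fun x ↦ g (x - c / x))
  change ∫⁻ x in S '' Set.univ, _ = ∫⁻ u in Set.univ, _ * g (S u - c / S u) at key
  rw [himg, setLIntegral_univ] at key
  rw [key]
  refine lintegral_congr fun u ↦ ?_
  rw [hSinv, abs_of_nonneg]
  have hpos : 0 < √(u ^ 2 + 4 * c) := (abs_nonneg u).trans_lt (habs u)
  have : -1 ≤ ε * u / √(u ^ 2 + 4 * c) := by
    rw [le_div_iff₀ hpos]
    linarith [neg_abs_le (ε * u), hεu u]
  rw [← mul_div_assoc]
  linarith

/-- The Cauchy–Schlömilch transformation: `x ↦ x - c / x` preserves Lebesgue measure. -/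
lemma lintegral_comp_sub_div {c : ℝ} (hc : 0 ≤ c) {g : ℝ → ℝ≥0∞} (hg : Measurable g) :
    ∫⁻ x, g (x - c / x) = ∫⁻ x, g x := by
  obtain rfl | hc := hc.eq_or_lt
  · simp
  have hcompl : (({x : ℝ | 0 < 1 * x})ᶜ : Set ℝ) =ᵐ[volume] {x : ℝ | 0 < -1 * x} := by
    have h1 : (({x : ℝ | 0 < 1 * x})ᶜ : Set ℝ) = Set.Iic 0 := by ext; simp
    have h2 : {x : ℝ | 0 < -1 * x} = Set.Iio 0 := by ext; simp
    rw [h1, h2]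
    exact Iio_ae_eq_Iic.symm
  rw [← lintegral_add_compl _ (measurableSet_lt measurable_const (by fun_prop) :
      MeasurableSet {x : ℝ | 0 < 1 * x}), setLIntegral_congr hcompl,
    setLIntegral_comp_sub_div hc (by norm_num), setLIntegral_comp_sub_div hc (by norm_num),
    ← lintegral_add_left (by fun_prop)]
  refine lintegral_congr fun u ↦ ?_
  have hroot : |u / √(u ^ 2 + 4 * c)| ≤ 1 := by
    rw [abs_div, abs_of_nonneg (Real.sqrt_nonneg _)]
    exact div_le_one_of_le₀ (Real.abs_le_sqrt (by linarith)) (Real.sqrt_nonneg _)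
  rw [abs_le] at hroot
  rw [← add_mul, ← ENNReal.ofReal_add (by linarith) (by linarith)]
  ring_nf
  simp

lemma lintegral_gaussianReal_exp_neg_div_sq {c : ℝ} (hc : 0 ≤ c) :
    ∫⁻ z, ENNReal.ofReal (Real.exp (-(c ^ 2 / (2 * z ^ 2)))) ∂gaussianReal 0 1
      = ENNReal.ofReal (Real.exp (-c)) := by
  rw [gaussianReal_of_var_ne_zero 0 one_ne_zero,
    lintegral_withDensity_eq_lintegral_mul _ (measurable_gaussianPDF 0 1) (by fun_prop)]
  calc
    _ = ∫⁻ z, ENNReal.ofReal (Real.exp (-c)) * gaussianPDF 0 1 (z - c / z) := by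
      refine lintegral_congr_ae ?_
      filter_upwards [Measure.ae_ne volume (0 : ℝ)] with z hz
      rw [Pi.mul_apply, gaussianPDF, gaussianPDF, ← ENNReal.ofReal_mul (gaussianPDFReal_nonneg _ _ _),
        ← ENNReal.ofReal_mul (Real.exp_nonneg _), gaussianPDFReal, gaussianPDFReal, mul_assoc,
        mul_left_comm (Real.exp (-c)), ← Real.exp_add, ← Real.exp_add]
      congr 3
      simp
      field_simp
      ring
    _ = _ := by
      rw [lintegral_const_mul' _ _ ENNReal.ofReal_ne_top,
        lintegral_comp_sub_div hc (measurable_gaussianPDF 0 1),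
        lintegral_gaussianPDF_eq_one 0 one_ne_zero, mul_one]

lemma expMeasure_Ioi {r : ℝ} (hr : 0 < r) {t : ℝ} (ht : 0 ≤ t) :
    expMeasure r (Set.Ioi t) = ENNReal.ofReal (Real.exp (-(r * t))) := by
  have := isProbabilityMeasure_expMeasure hr
  rw [← Set.compl_Iic, prob_compl_eq_one_sub measurableSet_Iic, ← ofReal_cdf,
    cdf_expMeasure_eq hr, if_pos ht, ← ENNReal.ofReal_one,
    ← ENNReal.ofReal_sub _ (by simp; positivity)]
  simp

/-- If `Y ~ Exp(λ)` and `Z` is a standard Gaussian, independent, then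
`√Y · |Z|` is exponentially distributed with rate `√(2λ)`:
`ℙ(√Y·|Z| > w) = e^{−√(2λ) w}` for every `w ≥ 0`. -/
theorem sqrt_exp_times_abs_gaussian_is_exponential
    {Ω : Type*} [MeasurableSpace Ω] (P : Measure Ω) [IsProbabilityMeasure P]
    (lam : ℝ) (hlam : 0 < lam)
    (Y Z : Ω → ℝ) (hYm : Measurable Y) (hZm : Measurable Z)
    (hY : Measure.map Y P = expMeasure lam)
    (hZ : Measure.map Z P = gaussianReal 0 1)
    (hind : IndepFun Y Z P) :
    ∀ w : ℝ, 0 ≤ w →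
      P {ω | w < Real.sqrt (Y ω) * |Z ω|}
        = ENNReal.ofReal (Real.exp (-Real.sqrt (2 * lam) * w)) := by
  intro w hw
  have hs : MeasurableSet {p : ℝ × ℝ | w < √p.1 * |p.2|} :=
    measurableSet_lt measurable_const (by fun_prop)
  have := isProbabilityMeasure_expMeasure hlam
  have hjoint : P.map (fun ω ↦ (Y ω, Z ω)) = (expMeasure lam).prod (gaussianReal 0 1) := by
    rw [← hY, ← hZ]
    exact (indepFun_iff_map_prod_eq_prod_map_map hYm.aemeasurable hZm.aemeasurable).1 hind
  have hc : (0 : ℝ) ≤ √(2 * lam) * w := by positivity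
  calc
    _ = P.map (fun ω ↦ (Y ω, Z ω)) {p : ℝ × ℝ | w < √p.1 * |p.2|} :=
      (Measure.map_apply (hYm.prodMk hZm) hs).symm
    _ = ∫⁻ z, expMeasure lam {y | w < √y * |z|} ∂gaussianReal 0 1 := by
      rw [hjoint, Measure.prod_apply_symm hs]
      rfl
    _ = ∫⁻ z, ENNReal.ofReal (Real.exp (-((√(2 * lam) * w) ^ 2 / (2 * z ^ 2))))
          ∂gaussianReal 0 1 := by
      refine lintegral_congr_ae ?_
      filter_upwards [(gaussianReal_absolutelyContinuous 0 one_ne_zero).ae_le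
        (Measure.ae_ne volume (0 : ℝ))] with z hz
      have hset : {y | w < √y * |z|} = Set.Ioi (w ^ 2 / z ^ 2) := by
        ext y
        rw [Set.mem_ofPred_eq, Set.mem_Ioi, ← div_lt_iff₀ (abs_pos.2 hz),
          Real.lt_sqrt (by positivity), div_pow, sq_abs]
      rw [hset, expMeasure_Ioi hlam (by positivity), mul_pow, Real.sq_sqrt (by positivity)]
      congr 3
      field_simp
    _ = _ := by rw [lintegral_gaussianReal_exp_neg_div_sq hc, neg_mul]
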